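/- The series Ω = ∑_{p prime} (log p / p)² converges, and its sum satisfies 0.717297 < Ω < 0.750159. -/

import Mathlib

open Finset

/-- The sum of `f` over the primes at most `n`. -/
noncomputable def sumPrimesLE (f : ℕ → ℝ) (n : ℕ) : ℝ :=
  ∑ k ∈ range (n + 1), if k.Prime then f k else 0

theorem sumPrimesLE_succ (f : ℕ → ℝ) (n : ℕ) :
    sumPrimesLE f (n + 1) = sumPrimesLE f n + if (n + 1).Prime then f (n + 1) else 0 := by
  rw [sumPrimesLE, sum_range_succ, sumPrimesLE]

theorem sumPrimesLE_log_le (n : ℕ) : sumPrimesLE (fun k ↦ Real.log k) n ≤ Real.log 4 * n := by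
  have h := Chebyshev.theta_le_log4_mul_x (x := n) (Nat.cast_nonneg n)
  rwa [Chebyshev.theta_eq_sum_Icc, Nat.floor_natCast, ← Nat.range_succ_eq_Icc_zero,
    sum_filter] at h

theorem log_succ_le_log_add_inv {n : ℕ} (hn : 0 < n) :
    Real.log ((n : ℝ) + 1) ≤ Real.log n + 1 / n := by
  have hn' : (0 : ℝ) < n := by exact_mod_cast hn
  have h := Real.log_le_sub_one_of_pos (x := ((n : ℝ) + 1) / n) (by positivity)
  rw [Real.log_div (by positivity) hn'.ne'] at h
  have : ((n : ℝ) + 1) / n - 1 = 1 / n := by field_simp; ring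
  linarith

theorem two_le_log_natCast {n : ℕ} (hn : 8 ≤ n) : 2 ≤ Real.log n := by
  have h : Real.log ((2 : ℝ) ^ 3) ≤ Real.log n :=
    Real.log_le_log (by norm_num) (by norm_num; exact_mod_cast hn)
  rw [Real.log_pow] at h
  push_cast at h
  linarith [Real.log_two_gt_d9]

theorem log_div_sq_succ_le {n : ℕ} (hn : 8 ≤ n) :
    Real.log ((n : ℝ) + 1) / ((n : ℝ) + 1) ^ 2 ≤ Real.log n / (n : ℝ) ^ 2 := by
  have hn' : (8 : ℝ) ≤ n := by exact_mod_cast hn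
  have h1 := log_succ_le_log_add_inv (n := n) (by omega)
  have h2 := two_le_log_natCast hn
  rw [div_le_div_iff₀ (by positivity) (by positivity)]
  calc Real.log ((n : ℝ) + 1) * (n : ℝ) ^ 2 ≤ (Real.log n + 1 / n) * (n : ℝ) ^ 2 := by gcongr
    _ = Real.log n * (n : ℝ) ^ 2 + n := by field_simp
    _ ≤ _ := by nlinarith

theorem log_div_sq_succ_le_sub {n : ℕ} (hn : 8 ≤ n) :
    Real.log ((n : ℝ) + 1) / ((n : ℝ) + 1) ^ 2 ≤
      (Real.log n + 1) / n - (Real.log ((n : ℝ) + 1) + 1) / ((n : ℝ) + 1) := by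
  have hn' : (8 : ℝ) ≤ n := by exact_mod_cast hn
  have h1 := log_succ_le_log_add_inv (n := n) (by omega)
  have h2 : 2 ≤ Real.log ((n : ℝ) + 1) := by
    exact_mod_cast two_le_log_natCast (n := n + 1) (by omega)
  set L := Real.log ((n : ℝ) + 1)
  have h3 : (L - 1 / n + 1) / n ≤ (Real.log n + 1) / n := by gcongr; linarith
  refine le_trans ?_ (sub_le_sub_right h3 _)
  have key : (L - 1 / n + 1) / n - (L + 1) / ((n : ℝ) + 1) - L / ((n : ℝ) + 1) ^ 2 =
      (L * n - (n + 1)) / ((n : ℝ) ^ 2 * (n + 1) ^ 2) := by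
    field_simp
    ring
  have : 0 ≤ (L * n - (n + 1)) / ((n : ℝ) ^ 2 * ((n : ℝ) + 1) ^ 2) :=
    div_nonneg (by nlinarith) (by positivity)
  linarith

/-- An upper bound for `∑ (log p / p) ^ 2` over all primes, obtained from the primes up to `n` by
partial summation and Chebyshev's bound `θ(x) ≤ x log 4`. -/
noncomputable def primeSumMajorant (n : ℕ) : ℝ :=
  sumPrimesLE (fun k ↦ (Real.log k / k) ^ 2) n +
    (Real.log 4 * n - sumPrimesLE (fun k ↦ Real.log k) n) * (Real.log n / (n : ℝ) ^ 2) +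
    Real.log 4 * ((Real.log n + 1) / n)

theorem primeSumMajorant_succ_le {n : ℕ} (hn : 8 ≤ n) :
    primeSumMajorant (n + 1) ≤ primeSumMajorant n := by
  have hg := log_div_sq_succ_le hn
  have hG := log_div_sq_succ_le_sub hn
  have hθ := sumPrimesLE_log_le n
  have hc : 0 ≤ Real.log 4 := Real.log_nonneg (by norm_num)
  unfold primeSumMajorant
  rw [sumPrimesLE_succ, sumPrimesLE_succ]
  push_cast
  set T := sumPrimesLE (fun k ↦ Real.log k) n
  set L := Real.log ((n : ℝ) + 1)
  have h1 := mul_le_mul_of_nonneg_left hg (sub_nonneg.2 hθ)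
  have h2 := mul_le_mul_of_nonneg_left hG hc
  split_ifs
  · have h3 : (L / ((n : ℝ) + 1)) ^ 2 = L * (L / ((n : ℝ) + 1) ^ 2) := by
      rw [div_pow, sq L, mul_div_assoc]
    rw [h3]
    linarith
  · linarith

theorem sumPrimesLE_le_primeSumMajorant {m n : ℕ} (hm : 8 ≤ m) (hmn : m ≤ n) :
    sumPrimesLE (fun k ↦ (Real.log k / k) ^ 2) n ≤ primeSumMajorant m := by
  have h : primeSumMajorant n ≤ primeSumMajorant m := by
    induction n, hmn using Nat.le_induction with
    | base => exact le_rfl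
    | succ n hn ih => exact (primeSumMajorant_succ_le (hm.trans hn)).trans ih
  refine le_trans ?_ h
  have hc : 0 ≤ Real.log 4 := Real.log_nonneg (by norm_num)
  have hL : 0 ≤ Real.log n := Real.log_natCast_nonneg n
  have h1 := mul_nonneg (sub_nonneg.2 (sumPrimesLE_log_le n)) (by positivity :
    0 ≤ Real.log n / (n : ℝ) ^ 2)
  have h2 : 0 ≤ Real.log 4 * ((Real.log n + 1) / n) := by positivity
  unfold primeSumMajorant
  linarith

theorem log2_pow_mul_log_two_le {n : ℕ} (hn : 0 < n) (k : ℕ) :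
    (n ^ k).log2 * Real.log 2 ≤ k * Real.log n := by
  rw [← Real.log_pow, ← Real.log_pow]
  refine Real.log_le_log (by positivity) ?_
  exact_mod_cast Nat.log2_self_le (pow_pos hn k).ne'

theorem mul_log_le_log2_pow_add_one {n : ℕ} (hn : 0 < n) (k : ℕ) :
    k * Real.log n ≤ ((n ^ k).log2 + 1) * Real.log 2 := by
  have h : (n : ℝ) ^ k ≤ 2 ^ ((n ^ k).log2 + 1) := by exact_mod_cast Nat.lt_log2_self.le
  have := Real.log_le_log (by positivity) h
  rw [Real.log_pow, Real.log_pow] at this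
  exact_mod_cast this

/-- A primality test for `n < 33 ^ 2`; the large numeral is the product of the primes below `33`. -/
def isPrimeBool (n : ℕ) : Bool :=
  (Nat.ble 2 n && Nat.beq (Nat.gcd n 200560490130) 1) ||
    [2, 3, 5, 7, 11, 13, 17, 19, 23, 29, 31].any (Nat.beq n)

theorem isPrimeBool_iff {n : ℕ} (h : n < 33 ^ 2) : isPrimeBool n = true ↔ n.Prime := by
  have hdef : isPrimeBool n = true ↔ (2 ≤ n ∧ Nat.gcd n 200560490130 = 1) ∨
      n ∈ [2, 3, 5, 7, 11, 13, 17, 19, 23, 29, 31] := by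
    simp [isPrimeBool, Nat.ble_eq, Nat.beq_eq]
  have hprod : 200560490130 = [2, 3, 5, 7, 11, 13, 17, 19, 23, 29, 31].prod := by norm_num
  have hprime : ∀ a ∈ [2, 3, 5, 7, 11, 13, 17, 19, 23, 29, 31], a.Prime := by
    simp only [List.forall_mem_cons, List.not_mem_nil, IsEmpty.forall_iff, implies_true]
    norm_num
  rw [hdef]
  constructor
  · rintro (⟨h2, hg⟩ | hq)
    · by_contra hp
      have h3 := Nat.minFac_sq_le_self (by omega : 0 < n) hp
      have h4 : n.minFac < 33 := lt_of_pow_lt_pow_left₀ 2 (Nat.zero_le _) (h3.trans_lt h)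
      have h5 : n.minFac.Prime := Nat.minFac_prime (by omega)
      have h6 : ¬ n.minFac ∣ 200560490130 := fun hd ↦
        h5.one_lt.ne' (Nat.dvd_one.1 (by rw [← hg]; exact Nat.dvd_gcd n.minFac_dvd hd))
      generalize n.minFac = m at h4 h5 h6
      interval_cases m <;> first | (norm_num at h5; done) | norm_num at h6
    · exact hprime n hq
  · intro hp
    by_cases hd : n ∣ 200560490130
    · rw [hprod, hp.prime.dvd_prod_iff] at hd
      obtain ⟨a, ha, hna⟩ := hd
      rw [(Nat.prime_dvd_prime_iff_eq hp (hprime a ha)).1 hna]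
      exact Or.inr ha
    · exact Or.inl ⟨hp.two_le, hp.coprime_iff_not_dvd.2 hd⟩

/-- A version of `sumPrimesLE` for `n < 33 ^ 2` and values in `ℕ` that the kernel evaluates. -/
def natSumPrimesLE (f : ℕ → ℕ) : ℕ → ℕ
  | 0 => 0
  | n + 1 => Nat.add (natSumPrimesLE f n) (bif isPrimeBool (n + 1) then f (n + 1) else 0)

theorem natSumPrimesLE_cast (f : ℕ → ℕ) {n : ℕ} (hn : n < 33 ^ 2) :
    (natSumPrimesLE f n : ℝ) = sumPrimesLE (fun k ↦ (f k : ℝ)) n := by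
  induction n with
  | zero => simp [natSumPrimesLE, sumPrimesLE, Nat.not_prime_zero]
  | succ n ih =>
    rw [sumPrimesLE_succ, ← ih (by omega), natSumPrimesLE, Nat.add_eq, Nat.cast_add,
      Bool.cond_eq_ite]
    simp only [isPrimeBool_iff hn]
    split_ifs <;> simp

theorem sumPrimesLE_le_sumPrimesLE {f g : ℕ → ℝ} (h : ∀ p : ℕ, p.Prime → f p ≤ g p) (n : ℕ) :
    sumPrimesLE f n ≤ sumPrimesLE g n := by
  refine sum_le_sum fun k _ ↦ ?_
  split_ifs with hk
  exacts [h k hk, le_rfl]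

theorem mul_sumPrimesLE (c : ℝ) (f : ℕ → ℝ) (n : ℕ) :
    c * sumPrimesLE f n = sumPrimesLE (fun k ↦ c * f k) n := by
  simp [sumPrimesLE, mul_sum]

theorem le_sumPrimesLE_log {n : ℕ} (hn : n < 33 ^ 2) :
    Real.log 2 / 256 * natSumPrimesLE (fun p ↦ (p ^ 256).log2) n ≤
      sumPrimesLE (fun k ↦ Real.log k) n := by
  rw [natSumPrimesLE_cast _ hn, mul_sumPrimesLE]
  refine sumPrimesLE_le_sumPrimesLE (fun p hp ↦ ?_) n
  have := log2_pow_mul_log_two_le hp.pos 256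
  push_cast at this
  linarith

theorem le_sumPrimesLE_log_div_sq {n : ℕ} (hn : n < 33 ^ 2) :
    Real.log 2 ^ 2 / 10 ^ 8 *
      natSumPrimesLE (fun p ↦ 10 ^ 8 * (p ^ 256).log2 ^ 2 / (256 * p) ^ 2) n ≤
      sumPrimesLE (fun k ↦ (Real.log k / k) ^ 2) n := by
  rw [natSumPrimesLE_cast _ hn, mul_sumPrimesLE]
  refine sumPrimesLE_le_sumPrimesLE (fun p hp ↦ ?_) n
  have hp0 : (0 : ℝ) < p := by exact_mod_cast hp.pos
  have h := log2_pow_mul_log_two_le hp.pos 256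
  have hl : 0 < Real.log 2 := Real.log_pos (by norm_num)
  generalize (p ^ 256).log2 = l at h
  push_cast at h
  have h1 : ((10 ^ 8 * l ^ 2 / (256 * p) ^ 2 : ℕ) : ℝ) ≤
      10 ^ 8 * (l : ℝ) ^ 2 / (256 * p) ^ 2 := by
    exact_mod_cast Nat.cast_div_le (α := ℝ) (m := 10 ^ 8 * l ^ 2) (n := (256 * p) ^ 2)
  calc _ ≤ Real.log 2 ^ 2 / 10 ^ 8 * (10 ^ 8 * (l : ℝ) ^ 2 / (256 * p) ^ 2) := by gcongr
    _ = (l * Real.log 2 / 256 / p) ^ 2 := by field_simp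
    _ ≤ _ := by gcongr; linarith

theorem sumPrimesLE_log_div_sq_le {n : ℕ} (hn : n < 33 ^ 2) :
    sumPrimesLE (fun k ↦ (Real.log k / k) ^ 2) n ≤ Real.log 2 ^ 2 / 10 ^ 8 *
      natSumPrimesLE (fun p ↦ 10 ^ 8 * ((p ^ 256).log2 + 1) ^ 2 / (256 * p) ^ 2 + 1) n := by
  rw [natSumPrimesLE_cast _ hn, mul_sumPrimesLE]
  refine sumPrimesLE_le_sumPrimesLE (fun p hp ↦ ?_) n
  have hp0 : (0 : ℝ) < p := by exact_mod_cast hp.pos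
  have h := mul_log_le_log2_pow_add_one hp.pos 256
  have hl : 0 < Real.log 2 := Real.log_pos (by norm_num)
  have hlp : 0 ≤ Real.log p := Real.log_natCast_nonneg p
  generalize (p ^ 256).log2 = l at h
  push_cast at h
  have h1 : 10 ^ 8 * ((l : ℝ) + 1) ^ 2 / (256 * p) ^ 2 ≤
      ((10 ^ 8 * (l + 1) ^ 2 / (256 * p) ^ 2 + 1 : ℕ) : ℝ) := by
    rw [div_le_iff₀ (by positivity)]
    exact_mod_cast ((Nat.lt_mul_div_succ _ (pow_pos (Nat.mul_pos (by norm_num) hp.pos) 2)).le.trans_eq (Nat.mul_comm _ _))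
  calc (Real.log p / p) ^ 2 ≤ ((l + 1) * Real.log 2 / 256 / p) ^ 2 := by gcongr; linarith
    _ = Real.log 2 ^ 2 / 10 ^ 8 * (10 ^ 8 * ((l : ℝ) + 1) ^ 2 / (256 * p) ^ 2) := by field_simp
    _ ≤ _ := by gcongr

theorem le_natSumPrimesLE_log2 :
    363315 ≤ natSumPrimesLE (fun p ↦ (p ^ 256).log2) 1024 := by
  decide +kernel

theorem le_natSumPrimesLE_log2_sq :
    150000000 ≤ natSumPrimesLE (fun p ↦ 10 ^ 8 * (p ^ 256).log2 ^ 2 / (256 * p) ^ 2) 512 := by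
  decide +kernel

theorem natSumPrimesLE_log2_sq_le :
    natSumPrimesLE (fun p ↦ 10 ^ 8 * ((p ^ 256).log2 + 1) ^ 2 / (256 * p) ^ 2 + 1) 1024 ≤
      153105288 := by
  decide +kernel

theorem lt_sumPrimesLE_log_div_sq :
    0.717297 < sumPrimesLE (fun k ↦ (Real.log k / k) ^ 2) 512 := by
  refine lt_of_lt_of_le ?_ (le_sumPrimesLE_log_div_sq (by norm_num))
  have hK := Nat.cast_le (α := ℝ).2 le_natSumPrimesLE_log2_sq
  rw [Nat.cast_ofNat] at hK
  have hl := Real.log_two_gt_d9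
  calc (0.717297 : ℝ) < 0.6931471803 ^ 2 / 10 ^ 8 * 150000000 := by norm_num
    _ ≤ _ := by gcongr

theorem primeSumMajorant_lt : primeSumMajorant 1024 < 0.750159 := by
  have hl := Real.log_two_gt_d9
  have hu := Real.log_two_lt_d9
  have hK := Nat.cast_le (α := ℝ).2 natSumPrimesLE_log2_sq_le
  have hT := Nat.cast_le (α := ℝ).2 le_natSumPrimesLE_log2
  rw [Nat.cast_ofNat] at hK hT
  have h1 := sumPrimesLE_log_div_sq_le (n := 1024) (by norm_num)
  have h2 := le_sumPrimesLE_log (n := 1024) (by norm_num)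
  have h3 : Real.log 4 = 2 * Real.log 2 := by
    rw [show (4 : ℝ) = 2 ^ 2 by norm_num, Real.log_pow]; norm_num
  have h4 : Real.log (1024 : ℕ) = 10 * Real.log 2 := by
    rw [show ((1024 : ℕ) : ℝ) = 2 ^ 10 by norm_num, Real.log_pow]; norm_num
  have h5 : Real.log 2 / 256 * 363315 ≤ sumPrimesLE (fun k ↦ Real.log k) 1024 :=
    le_trans (by gcongr) h2
  have h6 := h1.trans (mul_le_mul_of_nonneg_left hK (by positivity))
  have h7 : Real.log 2 ^ 2 ≤ 0.6931471808 ^ 2 := by gcongr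
  unfold primeSumMajorant
  rw [h3, h4]
  push_cast
  have h8 := mul_le_mul_of_nonneg_right (sub_le_sub_left h5 (2 * Real.log 2 * 1024))
    (by positivity : 0 ≤ 10 * Real.log 2 / (1024 : ℝ) ^ 2)
  linarith

/-- The series `Ω = ∑_{p prime} (log p / p)²` converges and
`0.717297 < Ω < 0.750159`. -/
theorem statement18 :
    Summable (fun p : Nat.Primes => (Real.log p / (p : ℝ)) ^ 2) ∧
    0.717297 < ∑' p : Nat.Primes, (Real.log p / (p : ℝ)) ^ 2 ∧
    ∑' p : Nat.Primes, (Real.log p / (p : ℝ)) ^ 2 < 0.750159 := by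
  set F : ℕ → ℝ := fun k ↦ if k.Prime then (Real.log k / k) ^ 2 else 0 with hF
  have hF0 : ∀ k, 0 ≤ F k := fun k ↦ by simp only [hF]; split_ifs <;> positivity
  have hbound : ∀ n, ∑ k ∈ range n, F k ≤ primeSumMajorant 1024 := fun n ↦
    (sum_le_sum_of_subset_of_nonneg (range_mono (by omega : n ≤ n + 1024 + 1))
      fun k _ _ ↦ hF0 k).trans (sumPrimesLE_le_primeSumMajorant (by norm_num) (by omega))
  have hsum : Summable F := summable_of_sum_range_le hF0 hbound
  have hprimes : HasSum (fun p : Nat.Primes => (Real.log p / (p : ℝ)) ^ 2) (∑' k, F k) := by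
    have h := (Function.Injective.hasSum_iff (f := F) (g := fun p : Nat.Primes ↦ (p : ℕ))
      Subtype.val_injective fun k hk ↦ if_neg fun hp ↦ hk ⟨⟨k, hp⟩, rfl⟩).2 hsum.hasSum
    refine h.congr_fun fun p ↦ ?_
    simp [hF, p.2]
  rw [hprimes.tsum_eq]
  exact ⟨hprimes.summable,
    lt_sumPrimesLE_log_div_sq.trans_le (hsum.sum_le_tsum _ fun k _ ↦ hF0 k),
    (hsum.tsum_le_of_sum_range_le hbound).trans_lt primeSumMajorant_lt⟩
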